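/- Intertwining relation: Θ_Y (D_α + D′_α) = D_α Θ_Y on 𝒫_Y, i.e. for every f ∈ 𝒫_Y, Θ_Y((D_α + D′_α) f) = D_α(Θ_Y f). -/

import Mathlib

open MvPolynomial

noncomputable section

/-- The base field `K = ℚ(b)`: rational functions in an indeterminate `b` over `ℚ`. -/
abbrev K : Type := RatFunc ℚ

/-- The indeterminate `b ∈ K`. -/
def bb : K := RatFunc.X

/-- `α = 1 + b`. -/
def alpha : K := 1 + bb

/-- Variables: `p i` (used for `i ≥ 1`) and `y i` (used for `i ≥ 0`). -/
inductive Var : Type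
  | p : ℕ → Var
  | y : ℕ → Var
  deriving DecidableEq

/-- The ambient polynomial ring `R = K[p₁, p₂, …, y₀, y₁, …]`. -/
abbrev R : Type := MvPolynomial Var K

/-- The variable `p_i`. -/
def P (i : ℕ) : R := X (Var.p i)

/-- The variable `y_i`. -/
def Y (i : ℕ) : R := X (Var.y i)

/-- Partial derivative `∂/∂p_i`. -/
def dP (i : ℕ) (f : R) : R := pderiv (Var.p i) f

/-- Partial derivative `∂/∂y_i`. -/
def dY (i : ℕ) (f : R) : R := pderiv (Var.y i) f

/-- `𝒫`: the subalgebra of polynomials in the `p`-variables only. -/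
def Psub : Subalgebra K R := MvPolynomial.supported K (Set.range Var.p)

/-- `𝒫_Y`: the `K`-linear span of the monomials `p_λ` and `y_i·p_λ`. -/
def PY : Submodule K R :=
  Submodule.span K ((Psub : Set R) ∪ {g : R | ∃ i : ℕ, ∃ f ∈ (Psub : Set R), g = Y i * f})

/-- The Laplace–Beltrami operator
`D_α = (1/2)(α Σ_{i,j≥1} i j p_{i+j} ∂²/∂p_i∂p_j + Σ_{i,j≥1} (i+j) p_i p_j ∂/∂p_{i+j}
        + b Σ_{i≥1} i(i−1) p_i ∂/∂p_i)`. -/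
def Dalpha (f : R) : R :=
  (2 : K)⁻¹ •
    (alpha • (∑ᶠ (i : ℕ) (j : ℕ), (((i + 1) * (j + 1) : ℕ) : K) •
        (P (i + 1 + (j + 1)) * dP (i + 1) (dP (j + 1) f)))
      + (∑ᶠ (i : ℕ) (j : ℕ), (((i + 1) + (j + 1) : ℕ) : K) •
        (P (i + 1) * P (j + 1) * dP (i + 1 + (j + 1)) f))
      + bb • (∑ᶠ (i : ℕ), (((i + 1) * i : ℕ) : K) • (P (i + 1) * dP (i + 1) f)))

/-- `Λ_Y = α Σ_{i,j≥1} i y_{i+j−1} ∂²/∂p_i∂y_{j−1} + Σ_{i,j≥1} y_{i−1} p_j ∂/∂y_{i+j−1}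
      + b Σ_{i≥1} i y_i ∂/∂y_i`. -/
def LamY (f : R) : R :=
  alpha • (∑ᶠ (i : ℕ) (j : ℕ), ((i + 1 : ℕ) : K) • (Y (i + j + 1) * dP (i + 1) (dY j f)))
    + (∑ᶠ (i : ℕ) (j : ℕ), Y i * P (j + 1) * dY (i + j + 1) f)
    + bb • (∑ᶠ (i : ℕ), ((i + 1 : ℕ) : K) • (Y (i + 1) * dY (i + 1) f))

/-- `Y_+ = Σ_{i≥0} y_{i+1} ∂/∂y_i`. -/
def Yplus (f : R) : R := ∑ᶠ (i : ℕ), Y (i + 1) * dY i f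

/-- `Θ_Y = Σ_{i≥1} p_i ∂/∂y_i`. -/
def ThetaY (f : R) : R := ∑ᶠ (i : ℕ), P (i + 1) * dY (i + 1) f

/-- `A j` is the operator `A_{j+1}` of the paper:
`A_{j+1} f = (1/(1+b))·Θ_Y(Y_+(Λ_Y^j(y₀·f)))`. -/
def A (j : ℕ) (f : R) : R := (1 + bb)⁻¹ • ThetaY (Yplus (LamY^[j] (Y 0 * f)))

/-- `D'_α = α Σ_{i,j≥1} i j y_{i+j} ∂²/∂y_i∂p_j + Σ_{i,j≥1} i y_i p_j ∂/∂y_{i+j}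
      + (b/2) Σ_{i≥1} i(i−1) y_i ∂/∂y_i`. -/
def D'alpha (f : R) : R :=
  alpha • (∑ᶠ (i : ℕ) (j : ℕ), (((i + 1) * (j + 1) : ℕ) : K) •
      (Y (i + 1 + (j + 1)) * dY (i + 1) (dP (j + 1) f)))
    + (∑ᶠ (i : ℕ) (j : ℕ), ((i + 1 : ℕ) : K) • (Y (i + 1) * P (j + 1) * dY (i + 1 + (j + 1)) f))
    + (bb * (2 : K)⁻¹) • (∑ᶠ (i : ℕ), (((i + 1) * i : ℕ) : K) • (Y (i + 1) * dY (i + 1) f))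

open Filter Finset

/-! ### Partial derivatives -/

theorem dP_add (i : ℕ) (f g : R) : dP i (f + g) = dP i f + dP i g := map_add _ _ _

theorem dP_smul (i : ℕ) (c : K) (f : R) : dP i (c • f) = c • dP i f := Derivation.map_smul _ _ _

theorem dP_mul (i : ℕ) (f g : R) : dP i (f * g) = dP i f * g + f * dP i g := pderiv_mul

theorem dP_P (i j : ℕ) : dP i (P j) = if i = j then 1 else 0 := by
  simp [dP, P, pderiv_X, Pi.single_apply, eq_comm]

theorem dP_Y (i j : ℕ) : dP i (Y j) = 0 := pderiv_X_of_ne (by simp)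

theorem dY_add (i : ℕ) (f g : R) : dY i (f + g) = dY i f + dY i g := map_add _ _ _

theorem dY_smul (i : ℕ) (c : K) (f : R) : dY i (c • f) = c • dY i f := Derivation.map_smul _ _ _

theorem dY_sum {ι : Type*} (i : ℕ) (s : Finset ι) (f : ι → R) :
    dY i (∑ j ∈ s, f j) = ∑ j ∈ s, dY i (f j) := map_sum _ _ _

theorem dY_mul (i : ℕ) (f g : R) : dY i (f * g) = dY i f * g + f * dY i g := pderiv_mul

theorem dY_Y (i j : ℕ) : dY i (Y j) = if i = j then 1 else 0 := by
  simp [dY, Y, pderiv_X, Pi.single_apply, eq_comm]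

theorem dY_P (i j : ℕ) : dY i (P j) = 0 := pderiv_X_of_ne (by simp)

theorem pderiv_comm (u v : Var) (f : R) :
    pderiv u (pderiv v f) = pderiv v (pderiv u f) := by
  have h : ⁅pderiv (R := K) u, pderiv (R := K) v⁆ = 0 := by
    refine derivation_ext fun w => ?_
    simp only [Derivation.commutator_apply, pderiv_X, Pi.single_apply]
    split_ifs <;> simp
  simpa [Derivation.commutator_apply, sub_eq_zero] using congrArg (fun D => D f) h

theorem dP_zero (i : ℕ) : dP i 0 = 0 := map_zero _

theorem dY_zero (i : ℕ) : dY i 0 = 0 := map_zero _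

theorem dY_dP (i j : ℕ) (f : R) : dY i (dP j f) = dP j (dY i f) := pderiv_comm _ _ _

theorem dY_eq_zero_of_mem_Psub {f : R} (hf : f ∈ Psub) (i : ℕ) : dY i f = 0 := by
  refine pderiv_eq_zero_of_notMem_vars fun h => ?_
  obtain ⟨j, hj⟩ := mem_supported.1 hf h
  cases hj

theorem dP_dP (i j : ℕ) (f : R) : dP i (dP j f) = dP j (dP i f) := pderiv_comm _ _ _

theorem eventually_pderiv_eq_zero {v : ℕ → Var} (hv : Function.Injective v) (f : R) :
    ∀ᶠ N in atTop, ∀ i ≥ N, pderiv (v i) f = 0 := by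
  have hfin : {i | v i ∈ f.vars}.Finite := f.vars.finite_toSet.preimage hv.injOn
  obtain ⟨M, hM⟩ := hfin.bddAbove
  filter_upwards [eventually_gt_atTop M] with N hN i hi
  exact pderiv_eq_zero_of_notMem_vars fun h => by
    have : i ≤ M := hM h
    omega

theorem eventually_dP_eq_zero (f : R) : ∀ᶠ N in atTop, ∀ i ≥ N, dP i f = 0 :=
  eventually_pderiv_eq_zero (fun _ _ h => by cases h; rfl) f

theorem eventually_dY_eq_zero (f : R) : ∀ᶠ N in atTop, ∀ i ≥ N, dY i f = 0 :=
  eventually_pderiv_eq_zero (fun _ _ h => by cases h; rfl) f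

/-! ### Truncation of locally finite sums -/

theorem finsum_eq_sum_range {M : Type*} [AddCommMonoid M] {N : ℕ} {F : ℕ → M}
    (h : ∀ i ≥ N, F i = 0) : ∑ᶠ i, F i = ∑ i ∈ range N, F i :=
  finsum_eq_finsetSum_of_support_subset F fun i hi => by
    simpa using not_le.1 fun hle => hi (h i hle)

theorem finsum_finsum_eq_sum_range {M : Type*} [AddCommMonoid M] {N : ℕ} {F : ℕ → ℕ → M}
    (h : ∀ i j, N ≤ i ∨ N ≤ j → F i j = 0) :
    ∑ᶠ (i : ℕ) (j : ℕ), F i j = ∑ i ∈ range N, ∑ j ∈ range N, F i j := by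
  rw [finsum_eq_sum_range (N := N) fun i hi => by simp [h i _ (.inl hi)]]
  exact sum_congr rfl fun i _ => finsum_eq_sum_range fun j hj => h i j (.inr hj)

/-- The truncation of `Dalpha` to indices at most `N`. -/
def DalphaTrunc (N : ℕ) (f : R) : R :=
  (2 : K)⁻¹ •
    (alpha • (∑ i ∈ range N, ∑ j ∈ range N, (((i + 1) * (j + 1) : ℕ) : K) •
        (P (i + 1 + (j + 1)) * dP (i + 1) (dP (j + 1) f)))
      + (∑ i ∈ range N, ∑ j ∈ range N, (((i + 1) + (j + 1) : ℕ) : K) •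
        (P (i + 1) * P (j + 1) * dP (i + 1 + (j + 1)) f))
      + bb • (∑ i ∈ range N, (((i + 1) * i : ℕ) : K) • (P (i + 1) * dP (i + 1) f)))

/-- The truncation of `D'alpha` to indices at most `N`. -/
def D'alphaTrunc (N : ℕ) (f : R) : R :=
  alpha • (∑ i ∈ range N, ∑ j ∈ range N, (((i + 1) * (j + 1) : ℕ) : K) •
      (Y (i + 1 + (j + 1)) * dY (i + 1) (dP (j + 1) f)))
    + (∑ i ∈ range N, ∑ j ∈ range N,
      ((i + 1 : ℕ) : K) • (Y (i + 1) * P (j + 1) * dY (i + 1 + (j + 1)) f))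
    + (bb * (2 : K)⁻¹) •
      (∑ i ∈ range N, (((i + 1) * i : ℕ) : K) • (Y (i + 1) * dY (i + 1) f))

/-- The truncation of `ThetaY` to indices at most `N`. -/
def ThetaYTrunc (N : ℕ) (f : R) : R := ∑ i ∈ range N, P (i + 1) * dY (i + 1) f

theorem eventually_Dalpha_eq (f : R) : ∀ᶠ N in atTop, Dalpha f = DalphaTrunc N f := by
  filter_upwards [eventually_dP_eq_zero f] with N hN
  have hP (i j : ℕ) (h : N ≤ i ∨ N ≤ j) : dP (i + 1) (dP (j + 1) f) = 0 := by
    rcases h with h | h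
    · rw [dP_dP, hN _ (by omega), dP_zero]
    · rw [hN _ (by omega), dP_zero]
  rw [Dalpha, DalphaTrunc, finsum_finsum_eq_sum_range (N := N) fun i j h => by simp [hP i j h],
    finsum_finsum_eq_sum_range (N := N) fun i j h => by rw [hN _ (by omega)]; simp,
    finsum_eq_sum_range (N := N) fun i h => by rw [hN _ (by omega)]; simp]

theorem eventually_D'alpha_eq (f : R) : ∀ᶠ N in atTop, D'alpha f = D'alphaTrunc N f := by
  filter_upwards [eventually_dP_eq_zero f, eventually_dY_eq_zero f] with N hP hY
  have hYP (i j : ℕ) (h : N ≤ i ∨ N ≤ j) : dY (i + 1) (dP (j + 1) f) = 0 := by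
    rcases h with h | h
    · rw [dY_dP, hY _ (by omega), dP_zero]
    · rw [hP _ (by omega), dY_zero]
  rw [D'alpha, D'alphaTrunc,
    finsum_finsum_eq_sum_range (N := N) fun i j h => by simp [hYP i j h],
    finsum_finsum_eq_sum_range (N := N) fun i j h => by rw [hY _ (by omega)]; simp,
    finsum_eq_sum_range (N := N) fun i h => by rw [hY _ (by omega)]; simp]

theorem eventually_ThetaY_eq (f : R) : ∀ᶠ N in atTop, ThetaY f = ThetaYTrunc N f := by
  filter_upwards [eventually_dY_eq_zero f] with N hY
  rw [ThetaY, ThetaYTrunc,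
    finsum_eq_sum_range (N := N) fun i h => by rw [hY _ (by omega)]; simp]

/-! ### Linearity -/

theorem isLinearMap_of_eventually_eq {T : R → R} {S : ℕ → R → R}
    (h : ∀ f, ∀ᶠ N in atTop, T f = S N f) (hS : ∀ N, IsLinearMap K (S N)) : IsLinearMap K T where
  map_add f g := by
    obtain ⟨N, h₁, h₂, h₃⟩ := ((h (f + g)).and ((h f).and (h g))).exists
    rw [h₁, h₂, h₃, (hS N).map_add]
  map_smul c f := by
    obtain ⟨N, h₁, h₂⟩ := ((h (c • f)).and (h f)).exists
    rw [h₁, h₂, (hS N).map_smul]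

theorem isLinearMap_Dalpha : IsLinearMap K Dalpha :=
  isLinearMap_of_eventually_eq eventually_Dalpha_eq fun N =>
    { map_add := fun f g => by
        simp only [DalphaTrunc, dP_add, mul_add, smul_add, sum_add_distrib]
        abel
      map_smul := fun c f => by
        simp only [DalphaTrunc, dP_smul, mul_smul_comm, smul_comm _ c, ← smul_sum, ← smul_add] }

theorem isLinearMap_D'alpha : IsLinearMap K D'alpha :=
  isLinearMap_of_eventually_eq eventually_D'alpha_eq fun N =>
    { map_add := fun f g => by
        simp only [D'alphaTrunc, dP_add, dY_add, mul_add, smul_add, sum_add_distrib]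
        abel
      map_smul := fun c f => by
        simp only [D'alphaTrunc, dP_smul, dY_smul, mul_smul_comm, smul_comm _ c, ← smul_sum,
          ← smul_add] }

theorem isLinearMap_ThetaY : IsLinearMap K ThetaY :=
  isLinearMap_of_eventually_eq eventually_ThetaY_eq fun N =>
    { map_add := fun f g => by
        simp only [ThetaYTrunc, dY_add, mul_add, sum_add_distrib]
      map_smul := fun c f => by
        simp only [ThetaYTrunc, dY_smul, mul_smul_comm, ← smul_sum] }

theorem ThetaY_add (f g : R) : ThetaY (f + g) = ThetaY f + ThetaY g :=
  isLinearMap_ThetaY.map_add f g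

theorem ThetaY_smul (c : K) (f : R) : ThetaY (c • f) = c • ThetaY f :=
  isLinearMap_ThetaY.map_smul c f

theorem ThetaY_sum {ι : Type*} (s : Finset ι) (f : ι → R) :
    ThetaY (∑ i ∈ s, f i) = ∑ i ∈ s, ThetaY (f i) :=
  map_sum (isLinearMap_ThetaY.mk' ThetaY) f s

/-! ### Action on polynomials of degree at most one in the `y`-variables -/

theorem ThetaY_eq_zero {f : R} (hf : ∀ i, dY i f = 0) : ThetaY f = 0 := by
  simp [ThetaY, hf]

theorem D'alpha_eq_zero {f : R} (hf : ∀ i, dY (i + 1) f = 0) : D'alpha f = 0 := by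
  have h (i j : ℕ) : dY (i + 1 + (j + 1)) f = 0 := hf (i + 1 + j)
  simp [D'alpha, dY_dP, hf, h, dP_zero]

theorem ThetaY_Y_zero_mul {f : R} (hf : ∀ i, dY i f = 0) : ThetaY (Y 0 * f) = 0 := by
  simp [ThetaY, dY_mul, dY_Y, hf]

theorem ThetaY_Y_succ_mul {f : R} (hf : ∀ i, dY i f = 0) (m : ℕ) :
    ThetaY (Y (m + 1) * f) = P (m + 1) * f := by
  rw [ThetaY, finsum_eq_single _ m fun i hi => by simp [dY_mul, dY_Y, hf, hi]]
  simp [dY_mul, dY_Y, hf]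

theorem dY_Dalpha {f : R} (hf : ∀ i, dY i f = 0) (i : ℕ) : dY i (Dalpha f) = 0 := by
  obtain ⟨N, hN⟩ := (eventually_Dalpha_eq f).exists
  simp [hN, DalphaTrunc, dY_add, dY_smul, dY_sum, dY_mul, dY_P, dY_dP, hf, dP_zero]

theorem Dalpha_Y_mul (k : ℕ) (f : R) : Dalpha (Y k * f) = Y k * Dalpha f := by
  obtain ⟨N, h₁, h₂⟩ := ((eventually_Dalpha_eq (Y k * f)).and (eventually_Dalpha_eq f)).exists
  simp only [h₁, h₂, DalphaTrunc, dP_mul, dP_Y, zero_mul, zero_add, mul_left_comm _ (Y k),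
    ← mul_smul_comm, ← mul_sum, ← mul_add]

theorem half_smul_add_eq {F V : Type*} [Field F] [CharZero F] [AddCommGroup V] [Module F V]
    (a b : F) (u v w u' v' w' : V) :
    (2 : F)⁻¹ • (a • ((2 : F) • u + u') + ((2 : F) • v + v') + b • (w + w'))
      = (2 : F)⁻¹ • (a • u' + v' + b • w') + (a • u + v + (b * 2⁻¹) • w) := by
  module

/-- The commutator of `Dalpha` with multiplication by `p_{m+1}`. -/
theorem eventually_Dalpha_P_mul (m : ℕ) (f : R) :
    ∀ᶠ N in atTop, Dalpha (P (m + 1) * f) = P (m + 1) * Dalpha f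
      + (alpha • (∑ j ∈ range N, (((m + 1) * (j + 1) : ℕ) : K) •
          (P (m + 1 + (j + 1)) * dP (j + 1) f))
        + (∑ i ∈ range N, ∑ j ∈ range N, ((i + 1 : ℕ) : K) •
          (P (i + 1) * P (j + 1) * if i + 1 + (j + 1) = m + 1 then f else 0))
        + (bb * (2 : K)⁻¹) • ((((m + 1) * m : ℕ) : K) • (P (m + 1) * f))) := by
  filter_upwards [eventually_Dalpha_eq (P (m + 1) * f), eventually_Dalpha_eq f,
    eventually_gt_atTop m] with N h₁ h₂ hm
  have hm' : m ∈ range N := mem_range.2 hm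
  have hd (i : ℕ) : dP (i + 1) (P (m + 1) * f)
      = (if i = m then f else 0) + P (m + 1) * dP (i + 1) f := by
    simp [dP_mul, dP_P]
  have hd₂ (i j : ℕ) : dP (i + 1) (dP (j + 1) (P (m + 1) * f))
      = (if j = m then dP (i + 1) f else 0) + (if i = m then dP (j + 1) f else 0)
        + P (m + 1) * dP (i + 1) (dP (j + 1) f) := by
    rw [hd, dP_add, dP_mul, dP_P]
    split_ifs <;> simp_all [dP_zero, add_assoc]
  have hd₁ (i j : ℕ) : dP (i + 1 + (j + 1)) (P (m + 1) * f)
      = (if i + 1 + (j + 1) = m + 1 then f else 0) + P (m + 1) * dP (i + 1 + (j + 1)) f := by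
    simp [dP_mul, dP_P]
  have hsymm : ∑ i ∈ range N, ∑ j ∈ range N, ((j + 1 : ℕ) : K) •
        (P (i + 1) * P (j + 1) * if i + 1 + (j + 1) = m + 1 then f else 0)
      = ∑ i ∈ range N, ∑ j ∈ range N, ((i + 1 : ℕ) : K) •
        (P (i + 1) * P (j + 1) * if i + 1 + (j + 1) = m + 1 then f else 0) := by
    rw [sum_comm]
    simp only [mul_comm (P _) (P _), add_comm (_ + 1) (_ + 1)]
  have h₂' : ∑ i ∈ range N, ∑ j ∈ range N, (((i + 1) * (j + 1) : ℕ) : K) •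
        (P (i + 1 + (j + 1)) * dP (i + 1) (dP (j + 1) (P (m + 1) * f)))
      = (2 : K) • (∑ j ∈ range N, (((m + 1) * (j + 1) : ℕ) : K) •
          (P (m + 1 + (j + 1)) * dP (j + 1) f))
        + P (m + 1) * ∑ i ∈ range N, ∑ j ∈ range N, (((i + 1) * (j + 1) : ℕ) : K) •
          (P (i + 1 + (j + 1)) * dP (i + 1) (dP (j + 1) f)) := by
    simp only [hd₂, mul_add, smul_add, sum_add_distrib, mul_left_comm _ (P (m + 1)),
      ← mul_smul_comm, ← mul_sum, two_smul]
    congr 2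
    · refine sum_congr rfl fun i _ => ?_
      rw [sum_eq_single_of_mem m hm' fun j _ hj => by simp [hj]]
      rw [if_pos rfl, add_comm (m + 1), ← mul_add, ← mul_add, mul_comm (m + 1)]
    · rw [sum_eq_single_of_mem m hm' fun i _ hi => by simp [hi]]
      simp
  have h₁' : ∑ i ∈ range N, ∑ j ∈ range N, (((i + 1) + (j + 1) : ℕ) : K) •
        (P (i + 1) * P (j + 1) * dP (i + 1 + (j + 1)) (P (m + 1) * f))
      = (2 : K) • (∑ i ∈ range N, ∑ j ∈ range N, ((i + 1 : ℕ) : K) •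
          (P (i + 1) * P (j + 1) * if i + 1 + (j + 1) = m + 1 then f else 0))
        + P (m + 1) * ∑ i ∈ range N, ∑ j ∈ range N, (((i + 1) + (j + 1) : ℕ) : K) •
          (P (i + 1) * P (j + 1) * dP (i + 1 + (j + 1)) f) := by
    simp only [hd₁, mul_add, smul_add, sum_add_distrib, mul_left_comm _ (P (m + 1)), mul_sum,
      ← mul_smul_comm (_ : K) (P (m + 1)), two_smul]
    congr 1
    nth_rw 2 [← hsymm]
    simp only [Nat.cast_add (_ + 1), add_smul, sum_add_distrib]
  have h₀' : ∑ i ∈ range N, (((i + 1) * i : ℕ) : K) • (P (i + 1) * dP (i + 1) (P (m + 1) * f))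
      = (((m + 1) * m : ℕ) : K) • (P (m + 1) * f)
        + P (m + 1) * ∑ i ∈ range N, (((i + 1) * i : ℕ) : K) • (P (i + 1) * dP (i + 1) f) := by
    simp only [hd, mul_add, smul_add, sum_add_distrib, mul_left_comm _ (P (m + 1)),
      ← mul_smul_comm, ← mul_sum]
    congr 1
    rw [sum_eq_single_of_mem m hm' fun i _ hi => by simp [hi]]
    simp
  rw [h₁, h₂, DalphaTrunc, DalphaTrunc, h₂', h₁', h₀']
  rw [mul_smul_comm, mul_add, mul_add, mul_smul_comm, mul_smul_comm]
  exact half_smul_add_eq ..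

theorem eventually_ThetaY_D'alpha_Y_mul (m : ℕ) {f : R} (hf : ∀ i, dY i f = 0) :
    ∀ᶠ N in atTop, ThetaY (D'alpha (Y (m + 1) * f)) =
      alpha • (∑ j ∈ range N, (((m + 1) * (j + 1) : ℕ) : K) •
          (P (m + 1 + (j + 1)) * dP (j + 1) f))
        + (∑ i ∈ range N, ∑ j ∈ range N, ((i + 1 : ℕ) : K) •
          (P (i + 1) * P (j + 1) * if i + 1 + (j + 1) = m + 1 then f else 0))
        + (bb * (2 : K)⁻¹) • ((((m + 1) * m : ℕ) : K) • (P (m + 1) * f)) := by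
  filter_upwards [eventually_D'alpha_eq (Y (m + 1) * f), eventually_gt_atTop m] with N h hm
  have hd (i j : ℕ) : dY (i + 1) (dP (j + 1) (Y (m + 1) * f))
      = if i = m then dP (j + 1) f else 0 := by
    simp [dP_mul, dP_Y, dY_mul, dY_Y, dY_dP, hf, dP_zero]
  have hd₁ (i : ℕ) : dY i (Y (m + 1) * f) = if i = m + 1 then f else 0 := by
    simp [dY_mul, dY_Y, hf]
  have hΘ₁ (i j k : ℕ) : ThetaY (Y (i + 1) * (P (j + 1) * if k = m + 1 then f else 0))
      = P (i + 1) * (P (j + 1) * if k = m + 1 then f else 0) := by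
    refine ThetaY_Y_succ_mul (fun l => ?_) i
    split_ifs <;> simp [dY_mul, dY_P, hf, dY_zero]
  have hΘ₂ (j : ℕ) : ThetaY (Y (m + 1 + (j + 1)) * dP (j + 1) f)
      = P (m + 1 + (j + 1)) * dP (j + 1) f :=
    ThetaY_Y_succ_mul (fun l => by rw [dY_dP, hf, dP_zero]) (m + 1 + j)
  have h₂ : ∑ i ∈ range N, ∑ j ∈ range N, (((i + 1) * (j + 1) : ℕ) : K) •
        (Y (i + 1 + (j + 1)) * dY (i + 1) (dP (j + 1) (Y (m + 1) * f)))
      = ∑ j ∈ range N, (((m + 1) * (j + 1) : ℕ) : K) •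
        (Y (m + 1 + (j + 1)) * dP (j + 1) f) := by
    rw [sum_eq_single_of_mem m (mem_range.2 hm) fun i _ hi => by simp [hd, hi]]
    simp [hd]
  have h₀ : ∑ i ∈ range N, (((i + 1) * i : ℕ) : K) • (Y (i + 1) * dY (i + 1) (Y (m + 1) * f))
      = (((m + 1) * m : ℕ) : K) • (Y (m + 1) * f) := by
    rw [sum_eq_single_of_mem m (mem_range.2 hm) fun i _ hi => by simp [hd₁, hi]]
    simp [hd₁]
  rw [h, D'alphaTrunc, h₂, h₀]
  simp only [hd₁, ThetaY_add, ThetaY_smul, ThetaY_sum, mul_assoc, hΘ₁,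
    hΘ₂, ThetaY_Y_succ_mul hf]

/-- `Θ_Y (D_α + D′_α) = D_α Θ_Y` on `𝒫_Y` (relation (4.4c) of Chapuy–Dołęga). -/
theorem ThetaY_intertwines :
    ∀ f ∈ PY, ThetaY (Dalpha f + D'alpha f) = Dalpha (ThetaY f) := by
  intro f hf
  induction hf using Submodule.span_induction with
  | zero =>
    simp only [isLinearMap_Dalpha.map_zero, isLinearMap_D'alpha.map_zero, add_zero,
      isLinearMap_ThetaY.map_zero]
  | add f g _ _ hf hg =>
    rw [ThetaY_add f g, isLinearMap_Dalpha.map_add (ThetaY f), ← hf, ← hg, ← ThetaY_add,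
      isLinearMap_Dalpha.map_add, isLinearMap_D'alpha.map_add, add_add_add_comm]
  | smul c f _ hf =>
    rw [ThetaY_smul c f, isLinearMap_Dalpha.map_smul c (ThetaY f), ← hf, ← ThetaY_smul,
      isLinearMap_Dalpha.map_smul, isLinearMap_D'alpha.map_smul, smul_add]
  | mem f hf =>
    rcases hf with hf | ⟨k, g, hg, rfl⟩
    · have hf := dY_eq_zero_of_mem_Psub hf
      rw [D'alpha_eq_zero fun i => hf _, add_zero, ThetaY_eq_zero (dY_Dalpha hf),
        ThetaY_eq_zero hf, isLinearMap_Dalpha.map_zero]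
    have hg := dY_eq_zero_of_mem_Psub hg
    rw [Dalpha_Y_mul, ThetaY_add]
    cases k with
    | zero =>
      rw [ThetaY_Y_zero_mul (dY_Dalpha hg), ThetaY_Y_zero_mul hg,
        D'alpha_eq_zero fun i => by simp [dY_mul, dY_Y, hg], isLinearMap_ThetaY.map_zero,
        isLinearMap_Dalpha.map_zero, add_zero]
    | succ m =>
      rw [ThetaY_Y_succ_mul (dY_Dalpha hg), ThetaY_Y_succ_mul hg]
      obtain ⟨N, h₁, h₂⟩ :=
        ((eventually_Dalpha_P_mul m g).and (eventually_ThetaY_D'alpha_Y_mul m hg)).exists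
      rw [h₁, h₂]
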